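/- For all integers m, n ≥ 2 there exist positive margins u ∈ ℝ^m and v ∈ ℝ^n and two vertices O and F of the m×n transportation polytope P(u,v) whose graph distance in P(u,v) is at least min{(m−1)(n−1), m+n−1}. -/

import Mathlib

/-- The m×n transportation polytope with margins u, v. -/
def TP (m n : ℕ) (u : Fin m → ℝ) (v : Fin n → ℝ) : Set (Matrix (Fin m) (Fin n) ℝ) :=
  {y | (∀ i j, 0 ≤ y i j) ∧ (∀ i, ∑ j, y i j = u i) ∧ (∀ j, ∑ i, y i j = v j)}

/-- Two distinct vertices of the transportation polytope are adjacent if the closed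
segment between them is an extreme subset of the polytope. -/
def AdjVert (m n : ℕ) (u : Fin m → ℝ) (v : Fin n → ℝ)
    (y z : Matrix (Fin m) (Fin n) ℝ) : Prop :=
  y ≠ z ∧ y ∈ Set.extremePoints ℝ (TP m n u v) ∧ z ∈ Set.extremePoints ℝ (TP m n u v) ∧
    IsExtreme ℝ (TP m n u v) (segment ℝ y z)

/-- incidence matrix of a set of cells -/
def inc {m n : ℕ} (S : Finset (Fin m × Fin n)) : Matrix (Fin m ⊕ Fin n) S ℝ :=
  fun r s => Sum.elim (fun i => if s.1.1 = i then (1 : ℝ) else 0)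
    (fun j => if s.1.2 = j then (1 : ℝ) else 0) r

lemma inc_row {m n : ℕ} (S : Finset (Fin m × Fin n)) (D : Matrix (Fin m) (Fin n) ℝ)
    (hD : ∀ i j, (i, j) ∉ S → D i j = 0) (i : Fin m) :
    ((inc S).mulVec (fun s => D s.1.1 s.1.2)) (Sum.inl i) = ∑ j, D i j := by
  simp only [Matrix.mulVec, dotProduct, inc, Sum.elim_inl]
  rw [Finset.sum_coe_sort S (fun p => (if p.1 = i then (1 : ℝ) else 0) * D p.1 p.2)]
  rw [Finset.sum_subset (Finset.subset_univ S)]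
  · rw [Fintype.sum_prod_type]
    simp
  · rintro ⟨a, b⟩ _ h
    simp [hD a b h]

lemma inc_col {m n : ℕ} (S : Finset (Fin m × Fin n)) (D : Matrix (Fin m) (Fin n) ℝ)
    (hD : ∀ i j, (i, j) ∉ S → D i j = 0) (j : Fin n) :
    ((inc S).mulVec (fun s => D s.1.1 s.1.2)) (Sum.inr j) = ∑ i, D i j := by
  simp only [Matrix.mulVec, dotProduct, inc, Sum.elim_inr]
  rw [Finset.sum_coe_sort S (fun p => (if p.2 = j then (1 : ℝ) else 0) * D p.1 p.2)]
  rw [Finset.sum_subset (Finset.subset_univ S)]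
  · rw [Fintype.sum_prod_type]
    simp
  · rintro ⟨a, b⟩ _ h
    simp [hD a b h]

lemma inc_tr {m n : ℕ} (S : Finset (Fin m × Fin n)) (a : Fin m ⊕ Fin n → ℝ) (s : S) :
    ((inc S).transpose.mulVec a) s = a (Sum.inl s.1.1) + a (Sum.inr s.1.2) := by
  simp [Matrix.mulVec, dotProduct, inc]

/-- Every element of the kernel is the restriction of a matrix with zero margins. -/
lemma inc_ker {m n : ℕ} (S : Finset (Fin m × Fin n)) (x : S → ℝ)
    (hx : (inc S).mulVec x = 0) :
    ∃ D : Matrix (Fin m) (Fin n) ℝ, (∀ i j, (i, j) ∉ S → D i j = 0) ∧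
      (∀ i, ∑ j, D i j = 0) ∧ (∀ j, ∑ i, D i j = 0) ∧ x = fun s => D s.1.1 s.1.2 := by
  classical
  let D : Matrix (Fin m) (Fin n) ℝ := fun i j => if h : (i, j) ∈ S then x ⟨(i, j), h⟩ else 0
  have h0 : ∀ i j, (i, j) ∉ S → D i j = 0 := by
    intro i j h
    simp [D, h]
  have hxD : x = fun s => D s.1.1 s.1.2 := by
    funext s
    simp [D]
  refine ⟨D, h0, fun i => ?_, fun j => ?_, hxD⟩
  · rw [← inc_row S D h0, ← hxD, hx]; rfl
  · rw [← inc_col S D h0, ← hxD, hx]; rfl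

lemma inc_rank_le {m n : ℕ} (hm : 0 < m) (S : Finset (Fin m × Fin n)) :
    (inc S).rank + 1 ≤ m + n := by
  have h1 := (inc S).transpose.mulVecLin.finrank_range_add_finrank_ker
  have h2 : 0 < Module.finrank ℝ (LinearMap.ker (inc S).transpose.mulVecLin) := by
    rw [Module.finrank_pos_iff_exists_ne_zero]
    refine ⟨⟨Sum.elim (fun _ => 1) (fun _ => -1), ?_⟩, ?_⟩
    · rw [LinearMap.mem_ker]
      funext s
      simp only [Matrix.mulVecLin_apply, inc_tr]
      simp
    · intro h
      have := congrFun (congrArg Subtype.val h) (Sum.inl ⟨0, hm⟩)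
      simp at this
  have h3 : (inc S).rank = Module.finrank ℝ (LinearMap.range (inc S).transpose.mulVecLin) := by
    rw [← Matrix.rank_transpose]; rfl
  simp at h1
  omega

lemma inc_rank_ge {m n : ℕ} (S : Finset (Fin m × Fin n))
    (h : ∀ (a : Fin m → ℝ) (b : Fin n → ℝ), (∀ i j, (i, j) ∈ S → a i + b j = 0) →
      ∃ c, (∀ i, a i = c) ∧ ∀ j, b j = -c) :
    m + n ≤ (inc S).rank + 1 := by
  have h1 := (inc S).transpose.mulVecLin.finrank_range_add_finrank_ker
  have h2 : Module.finrank ℝ (LinearMap.ker (inc S).transpose.mulVecLin) ≤ 1 := by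
    refine finrank_le_one ⟨Sum.elim (fun _ => 1) (fun _ => -1), ?_⟩ ?_
    · rw [LinearMap.mem_ker]
      funext s
      simp only [Matrix.mulVecLin_apply, inc_tr]
      simp
    · rintro ⟨w, hw⟩
      rw [LinearMap.mem_ker] at hw
      obtain ⟨c, hc1, hc2⟩ := h (fun i => w (Sum.inl i)) (fun j => w (Sum.inr j)) (by
        intro i j hij
        have := congrFun hw ⟨(i, j), hij⟩
        simp only [Matrix.mulVecLin_apply, inc_tr] at this
        exact this)
      refine ⟨c, Subtype.ext ?_⟩
      funext r
      rcases r with i | j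
      · simp [hc1 i]
      · simp [hc2 j]
  have h3 : (inc S).rank = Module.finrank ℝ (LinearMap.range (inc S).transpose.mulVecLin) := by
    rw [← Matrix.rank_transpose]; rfl
  simp at h1
  omega

lemma inc_rn {m n : ℕ} (S : Finset (Fin m × Fin n)) :
    (inc S).rank + Module.finrank ℝ (LinearMap.ker (inc S).mulVecLin) = S.card := by
  have h1 := (inc S).mulVecLin.finrank_range_add_finrank_ker
  simp at h1
  exact h1

/-- Nondegenerate margins. -/
def Nondeg {m n : ℕ} (u : Fin m → ℝ) (v : Fin n → ℝ) : Prop :=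
  ∀ (I : Finset (Fin m)) (J : Finset (Fin n)), ∑ i ∈ I, u i = ∑ j ∈ J, v j →
    (I = ∅ ∧ J = ∅) ∨ (I = Finset.univ ∧ J = Finset.univ)

open Classical in
noncomputable def supp {m n : ℕ} (y : Matrix (Fin m) (Fin n) ℝ) : Finset (Fin m × Fin n) :=
  Finset.univ.filter (fun p => y p.1 p.2 ≠ 0)

lemma mem_supp {m n : ℕ} (y : Matrix (Fin m) (Fin n) ℝ) (i : Fin m) (j : Fin n) :
    (i, j) ∈ supp y ↔ y i j ≠ 0 := by
  simp [supp]

lemma rank_supp {m n : ℕ} (hm : 0 < m) {u : Fin m → ℝ} {v : Fin n → ℝ} (hN : Nondeg u v)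
    {y : Matrix (Fin m) (Fin n) ℝ} (hy : y ∈ TP m n u v) : m + n ≤ (inc (supp y)).rank + 1 := by
  classical
  apply inc_rank_ge
  intro a b hab
  set i0 : Fin m := ⟨0, hm⟩
  obtain ⟨_, hr, hc⟩ := hy
  have key : ∀ i j, a i ≠ a i0 ∧ b j = - a i0 ∨ a i = a i0 ∧ b j ≠ - a i0 → y i j = 0 := by
    intro i j h
    by_contra h0
    have := hab i j ((mem_supp y i j).2 h0)
    rcases h with ⟨h1, h2⟩ | ⟨h1, h2⟩
    · apply h1; linarith
    · apply h2; linarith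
  have hs := hN (Finset.univ.filter (fun i => a i = a i0))
    (Finset.univ.filter (fun j => b j = - a i0)) (by
      simp only [← hr, ← hc]
      refine Eq.trans Finset.sum_comm ?_
      refine Eq.trans (Finset.sum_subset
        (Finset.subset_univ (Finset.univ.filter (fun j => b j = - a i0))) ?_).symm ?_
      rotate_left
      · refine Finset.sum_congr rfl fun j hj => ?_
        apply Finset.sum_subset (Finset.subset_univ _)
        intro i _ hi
        simp only [Finset.mem_filter, Finset.mem_univ, true_and] at hi hj
        exact key i j (Or.inl ⟨hi, hj⟩)
      · intro j _ hj
        apply Finset.sum_eq_zero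
        intro i hi
        simp only [Finset.mem_filter, Finset.mem_univ, true_and] at hi hj
        exact key i j (Or.inr ⟨hi, hj⟩))
  rcases hs with ⟨h1, _⟩ | ⟨h1, h2⟩
  · have : i0 ∈ Finset.univ.filter (fun i => a i = a i0) := by simp
    rw [h1] at this
    simp at this
  · refine ⟨a i0, fun i => ?_, fun j => ?_⟩
    · have := Finset.mem_univ i
      rw [← h1] at this
      simpa using this
    · have := Finset.mem_univ j
      rw [← h2] at this
      simpa using this

lemma card_supp_ge {m n : ℕ} (hm : 0 < m) {u : Fin m → ℝ} {v : Fin n → ℝ} (hN : Nondeg u v)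
    {y : Matrix (Fin m) (Fin n) ℝ} (hy : y ∈ TP m n u v) : m + n ≤ (supp y).card + 1 := by
  have := rank_supp hm hN hy
  have := inc_rn (supp y)
  omega

lemma extreme_of_card {m n : ℕ} (hm : 0 < m) {u : Fin m → ℝ} {v : Fin n → ℝ} (hN : Nondeg u v)
    {y : Matrix (Fin m) (Fin n) ℝ} (hy : y ∈ TP m n u v) (hc : (supp y).card + 1 ≤ m + n) :
    y ∈ Set.extremePoints ℝ (TP m n u v) := by
  have h1 := rank_supp hm hN hy
  have h2 := inc_rn (supp y)
  have h3 : Module.finrank ℝ (LinearMap.ker (inc (supp y)).mulVecLin) = 0 := by omega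
  rw [Submodule.finrank_eq_zero] at h3
  rw [mem_extremePoints_iff_left]
  refine ⟨hy, ?_⟩
  rintro x1 hx1 x2 hx2 ⟨α, β, hα, hβ, hαβ, hxy⟩
  have hxy' : ∀ i j, α * x1 i j + β * x2 i j = y i j := by
    intro i j
    rw [← hxy]; simp
  have hD : ∀ i j, (i, j) ∉ supp y → (x1 - y) i j = 0 := by
    intro i j hij
    rw [mem_supp, not_not] at hij
    have h := hxy' i j
    rw [hij] at h
    have := mul_nonneg hβ.le (hx2.1 i j)
    have h5 := mul_nonneg hα.le (hx1.1 i j)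
    have h6 : α * x1 i j = 0 := by linarith
    rcases mul_eq_zero.1 h6 with h7 | h7
    · exact absurd h7 hα.ne'
    · simp [h7, hij]
  have hk : (fun s : supp y => (x1 - y) s.1.1 s.1.2) ∈ LinearMap.ker (inc (supp y)).mulVecLin := by
    rw [LinearMap.mem_ker, Matrix.mulVecLin_apply]
    funext r
    rcases r with i | j
    · rw [inc_row _ _ hD]
      simp [Finset.sum_sub_distrib, hx1.2.1, hy.2.1]
    · rw [inc_col _ _ hD]
      simp [Finset.sum_sub_distrib, hx1.2.2, hy.2.2]
  rw [h3, Submodule.mem_bot] at hk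
  ext i j
  by_cases hij : (i, j) ∈ supp y
  · have := congrFun hk ⟨(i, j), hij⟩
    simp at this
    linarith
  · have := hD i j hij
    simp at this
    linarith

lemma exists_eps {m n : ℕ} (w D : Matrix (Fin m) (Fin n) ℝ) (hw : ∀ i j, 0 ≤ w i j)
    (h : ∀ i j, w i j = 0 → D i j = 0) : ∃ ε : ℝ, 0 < ε ∧ ∀ i j, ε * |D i j| ≤ w i j := by
  have h1 : ∀ᶠ ε : ℝ in nhdsWithin 0 (Set.Ioi 0), ∀ i j, ε * |D i j| ≤ w i j := by
    rw [Filter.eventually_all]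
    intro i
    rw [Filter.eventually_all]
    intro j
    by_cases h0 : w i j = 0
    · simp [h i j h0, h0]
    · have hp : 0 < w i j := lt_of_le_of_ne (hw i j) (Ne.symm h0)
      apply Filter.Eventually.filter_mono nhdsWithin_le_nhds
      have ht : Filter.Tendsto (fun ε : ℝ => ε * |D i j|) (nhds 0) (nhds (0 * |D i j|)) := by
        apply Continuous.tendsto
        fun_prop
      rw [zero_mul] at ht
      exact (ht.eventually (gt_mem_nhds hp)).mono (fun x hx => le_of_lt hx)
  have h2 : ∀ᶠ ε : ℝ in nhdsWithin 0 (Set.Ioi 0), 0 < ε := eventually_mem_nhdsWithin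
  obtain ⟨ε, h3, h4⟩ := (h2.and h1).exists
  exact ⟨ε, h3, h4⟩

lemma adj_card {m n : ℕ} (hm : 0 < m) {u : Fin m → ℝ} {v : Fin n → ℝ} (hN : Nondeg u v)
    {y z : Matrix (Fin m) (Fin n) ℝ} (h : AdjVert m n u v y z) :
    (supp z \ supp y).card ≤ 1 := by
  classical
  obtain ⟨_, hy, hz, hE⟩ := h
  have hy := hy.1
  have hz := hz.1
  have hker : Module.finrank ℝ (LinearMap.ker (inc (supp y ∪ supp z)).mulVecLin) ≤ 1 := by
    have hd0 : ∀ i j, (i, j) ∉ supp y ∪ supp z → (z - y) i j = 0 := by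
      intro i j hij
      rw [Finset.mem_union, not_or, mem_supp, mem_supp, not_not, not_not] at hij
      simp [hij.1, hij.2]
    refine finrank_le_one ⟨fun s => (z - y) s.1.1 s.1.2, ?_⟩ ?_
    · rw [LinearMap.mem_ker, Matrix.mulVecLin_apply]
      funext r
      rcases r with i | j
      · rw [inc_row _ _ hd0]
        simp [Finset.sum_sub_distrib, hz.2.1, hy.2.1]
      · rw [inc_col _ _ hd0]
        simp [Finset.sum_sub_distrib, hz.2.2, hy.2.2]
    · rintro ⟨x, hx⟩
      rw [LinearMap.mem_ker, Matrix.mulVecLin_apply] at hx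
      obtain ⟨D, hD, hDr, hDc, rfl⟩ := inc_ker _ x hx
      set w : Matrix (Fin m) (Fin n) ℝ := (1/2 : ℝ) • y + (1/2 : ℝ) • z with hwdef
      have hwij : ∀ i j, w i j = (y i j + z i j) / 2 := by
        intro i j
        simp [hwdef]; ring
      have hw0 : ∀ i j, 0 ≤ w i j := by
        intro i j
        rw [hwij]
        linarith [hy.1 i j, hz.1 i j]
      obtain ⟨ε, hε, hεw⟩ := exists_eps w D hw0 (by
        intro i j hij
        apply hD
        rw [hwij] at hij
        have := hy.1 i j
        have := hz.1 i j
        rw [Finset.mem_union, not_or, mem_supp, mem_supp, not_not, not_not]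
        constructor <;> linarith)
      have hwr : ∀ i, ∑ j, w i j = u i := by
        intro i
        simp only [hwij]
        rw [← Finset.sum_div, Finset.sum_add_distrib, hy.2.1, hz.2.1]; ring
      have hwc : ∀ j, ∑ i, w i j = v j := by
        intro j
        simp only [hwij]
        rw [← Finset.sum_div, Finset.sum_add_distrib, hy.2.2, hz.2.2]; ring
      have hmem : ∀ t : ℝ, |t| = ε → w + t • D ∈ TP m n u v := by
        intro t ht
        refine ⟨fun i j => ?_, fun i => ?_, fun j => ?_⟩
        · have h1 := hεw i j
          rw [← ht, ← abs_mul] at h1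
          have h2 := neg_abs_le (t * D i j)
          simp
          linarith
        · simp [Finset.sum_add_distrib, ← Finset.mul_sum, hDr, hwr]
        · simp [Finset.sum_add_distrib, ← Finset.mul_sum, hDc, hwc]
      have hseg : w ∈ segment ℝ y z := ⟨1/2, 1/2, by norm_num, by norm_num, by norm_num, rfl⟩
      have hx1 := hE.left_mem_of_mem_openSegment (hmem ε (abs_of_pos hε))
        (hmem (-ε) (by rw [abs_neg, abs_of_pos hε])) hseg
        ⟨1/2, 1/2, by norm_num, by norm_num, by norm_num, by
          ext i j
          simp
          ring⟩
      obtain ⟨α, β, _, _, hab, hab2⟩ := hx1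
      refine ⟨(β - 1/2) / ε, Subtype.ext ?_⟩
      funext s
      have h5 : α * y s.1.1 s.1.2 + β * z s.1.1 s.1.2 = w s.1.1 s.1.2 + ε * D s.1.1 s.1.2 := by
        have := congrFun (congrFun hab2 s.1.1) s.1.2
        simpa using this
      rw [hwij] at h5
      simp only [SetLike.mk_smul_mk, Pi.smul_apply, smul_eq_mul, Matrix.sub_apply]
      have hα : α = 1 - β := by linarith
      subst hα
      field_simp
      linarith
  have h1 := inc_rank_le hm (supp y ∪ supp z)
  have h2 := inc_rn (supp y ∪ supp z)
  have h3 := card_supp_ge hm hN hy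
  have h4 : (supp y ∪ supp z).card = (supp z \ supp y).card + (supp y).card := by
    rw [Finset.union_comm, ← Finset.card_sdiff_add_card]
  omega

lemma walk_card {m n : ℕ} (hm : 0 < m) {u : Fin m → ℝ} {v : Fin n → ℝ} (hN : Nondeg u v)
    (w : ℕ → Matrix (Fin m) (Fin n) ℝ) (k : ℕ)
    (h : ∀ i < k, AdjVert m n u v (w i) (w (i + 1))) :
    (supp (w k) \ supp (w 0)).card ≤ k := by
  classical
  induction k with
  | zero => simp
  | succ k ih =>
    have h1 := ih (fun i hi => h i (by omega))
    have h2 := adj_card hm hN (h k (by omega))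
    have h3 : supp (w (k + 1)) \ supp (w 0) ⊆
        (supp (w (k + 1)) \ supp (w k)) ∪ (supp (w k) \ supp (w 0)) := by
      intro p hp
      simp only [Finset.mem_union, Finset.mem_sdiff] at hp ⊢
      tauto
    have h4 := Finset.card_le_card h3
    have h5 := Finset.card_union_le (supp (w (k + 1)) \ supp (w k)) (supp (w k) \ supp (w 0))
    omega

/-- Combinatorial data sufficient for the theorem. -/
def Good (m n : ℕ) : Prop :=
  ∃ (u : Fin m → ℝ) (v : Fin n → ℝ), (∀ i, 0 < u i) ∧ (∀ j, 0 < v j) ∧ Nondeg u v ∧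
    ∃ O F : Matrix (Fin m) (Fin n) ℝ, O ∈ TP m n u v ∧ F ∈ TP m n u v ∧
      (supp O).card + 1 ≤ m + n ∧ (supp F).card + 1 ≤ m + n ∧
      ((∀ i j, O i j = 0 → F i j ≠ 0) ∨ (∀ i j, F i j ≠ 0 → O i j = 0))

lemma good_main (m n : ℕ) (hm : 2 ≤ m) (hn : 2 ≤ n) (h : Good m n) :
    ∃ (u : Fin m → ℝ) (v : Fin n → ℝ),
      (∀ i, 0 < u i) ∧ (∀ j, 0 < v j) ∧ (∑ i, u i = ∑ j, v j) ∧
      ∃ O F : Matrix (Fin m) (Fin n) ℝ,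
        O ∈ Set.extremePoints ℝ (TP m n u v) ∧
        F ∈ Set.extremePoints ℝ (TP m n u v) ∧
        ∀ (k : ℕ) (w : ℕ → Matrix (Fin m) (Fin n) ℝ),
          w 0 = O → w k = F →
          (∀ i < k, AdjVert m n u v (w i) (w (i + 1))) →
          min ((m - 1) * (n - 1)) (m + n - 1) ≤ k := by
  classical
  obtain ⟨u, v, hu, hv, hN, O, F, hO, hF, hcO, hcF, hOF⟩ := h
  have hm0 : 0 < m := by omega
  refine ⟨u, v, hu, hv, ?_, O, F, extreme_of_card hm0 hN hO hcO, extreme_of_card hm0 hN hF hcF, ?_⟩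
  · simp only [← hO.2.1, ← hO.2.2]
    exact Finset.sum_comm
  · intro k w h0 hk hw
    have h1 := walk_card hm0 hN w k hw
    rw [h0, hk] at h1
    have h2 := card_supp_ge hm0 hN hO
    have h3 := card_supp_ge hm0 hN hF
    rcases hOF with h | h
    · have h4 : Finset.univ ⊆ (supp F \ supp O) ∪ supp O := by
        rintro ⟨i, j⟩ _
        rw [Finset.mem_union, Finset.mem_sdiff, mem_supp, mem_supp]
        have := h i j
        tauto
      have h5 := (Finset.card_le_card h4).trans (Finset.card_union_le _ _)
      simp at h5
      apply (min_le_left _ _).trans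
      obtain ⟨m, rfl⟩ : ∃ m', m = m' + 1 := ⟨m - 1, by omega⟩
      obtain ⟨n, rfl⟩ : ∃ n', n = n' + 1 := ⟨n - 1, by omega⟩
      simp only [Nat.add_sub_cancel]
      nlinarith
    · have h4 : supp F \ supp O = supp F := by
        rw [Finset.sdiff_eq_self_iff_disjoint, Finset.disjoint_left]
        rintro ⟨i, j⟩ h6
        rw [mem_supp] at *
        simpa using h i j h6
      rw [h4] at h1
      apply (min_le_right _ _).trans
      omega

lemma good_symm {m n : ℕ} (h : Good m n) : Good n m := by
  classical
  obtain ⟨u, v, hu, hv, hN, O, F, hO, hF, hcO, hcF, hOF⟩ := h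
  have hc : ∀ y : Matrix (Fin m) (Fin n) ℝ, (supp y.transpose).card ≤ (supp y).card := by
    intro y
    apply Finset.card_le_card_of_injOn Prod.swap
    · rintro ⟨i, j⟩ h
      rw [Finset.mem_coe, mem_supp] at h
      rw [Finset.mem_coe]
      exact (mem_supp y j i).2 h
    · exact Prod.swap_injective.injOn
  refine ⟨v, u, hv, hu, ?_, O.transpose, F.transpose, ⟨fun i j => hO.1 j i, hO.2.2, hO.2.1⟩,
    ⟨fun i j => hF.1 j i, hF.2.2, hF.2.1⟩, ?_, ?_, ?_⟩
  · intro I J h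
    have := hN J I h.symm
    tauto
  · have := hc O; omega
  · have := hc F; omega
  · rcases hOF with h | h
    · exact Or.inl fun i j => h j i
    · exact Or.inr fun i j => h j i

lemma nondeg_of_mod {m n : ℕ} (c : Fin m → ℕ) (d : Fin n → ℕ)
    (hd : ∀ j, 0 < m * d j) (hs : ∑ i, (m * c i + 1) = ∑ j, m * d j) :
    Nondeg (fun i => ((m * c i + 1 : ℕ) : ℝ)) (fun j => ((m * d j : ℕ) : ℝ)) := by
  classical
  intro I J h
  have h1 : ∑ i ∈ I, (m * c i + 1) = ∑ j ∈ J, m * d j := by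
    beta_reduce at h
    exact_mod_cast h
  have h2 : m ∣ I.card := by
    have h3 : m * ∑ i ∈ I, c i + I.card = m * ∑ j ∈ J, d j := by
      rw [Finset.sum_add_distrib, ← Finset.mul_sum, ← Finset.mul_sum] at h1
      simpa using h1
    exact (Nat.dvd_add_right (Dvd.intro _ rfl)).1 (h3 ▸ Dvd.intro _ rfl)
  have h4 : I.card ≤ m := by simpa using Finset.card_le_univ I
  rcases Nat.eq_zero_or_pos I.card with h5 | h5
  · left
    rw [Finset.card_eq_zero] at h5
    subst h5
    refine ⟨rfl, ?_⟩
    rw [Finset.sum_empty] at h1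
    rw [Finset.eq_empty_iff_forall_notMem]
    intro j hj
    have := Finset.sum_eq_zero_iff.1 h1.symm j hj
    have := hd j
    omega
  · right
    have h6 : I.card = m := le_antisymm h4 (Nat.le_of_dvd h5 h2)
    have h7 : I = Finset.univ := by
      rw [← Finset.card_eq_iff_eq_univ, h6]; simp
    subst h7
    refine ⟨rfl, ?_⟩
    by_contra hJ
    obtain ⟨j, hj⟩ : ∃ j, j ∉ J := by
      by_contra h8
      push Not at h8
      exact hJ (Finset.eq_univ_of_forall h8)
    have : ∑ j ∈ J, m * d j < ∑ j, m * d j :=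
      Finset.sum_lt_sum_of_subset (Finset.subset_univ J) (Finset.mem_univ j) hj (hd j)
        (fun _ _ _ => Nat.zero_le _)
    omega

/-- corner value of the staircase -/
noncomputable def cor (m : ℕ) (b : ℕ → ℕ) (i p : ℕ) : ℝ :=
  min ((m * b i + i : ℕ) : ℝ) ((m * p : ℕ) : ℝ)

noncomputable def stair (m : ℕ) (b : ℕ → ℕ) (i p : ℕ) : ℝ :=
  cor m b (i + 1) (p + 1) - cor m b i (p + 1) - (cor m b (i + 1) p - cor m b i p)

lemma stair_nonneg (m : ℕ) (b : ℕ → ℕ) (hb : Monotone b) (i p : ℕ) : 0 ≤ stair m b i p := by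
  have h1 : ((m * b i + i : ℕ) : ℝ) ≤ ((m * b (i + 1) + (i + 1) : ℕ) : ℝ) := by
    have := Nat.mul_le_mul_left m (hb (Nat.le_succ i))
    exact_mod_cast (by simp at this; omega)
  have h2 : ((m * p : ℕ) : ℝ) ≤ ((m * (p + 1) : ℕ) : ℝ) := by
    exact_mod_cast Nat.mul_le_mul_left m (Nat.le_succ p)
  unfold stair cor
  generalize ((m * b i + i : ℕ) : ℝ) = x at *
  generalize ((m * b (i + 1) + (i + 1) : ℕ) : ℝ) = x' at *
  generalize ((m * p : ℕ) : ℝ) = c at *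
  generalize ((m * (p + 1) : ℕ) : ℝ) = c' at *
  simp only [min_def]
  split_ifs <;> linarith

lemma stair_ne (m : ℕ) (b : ℕ → ℕ) (hb : Monotone b) (i p : ℕ) (hi : i < m) :
    stair m b i p ≠ 0 ↔ b i ≤ p ∧ p ≤ b (i + 1) := by
  have h1 : ((m * b i + i : ℕ) : ℝ) < ((m * b (i + 1) + (i + 1) : ℕ) : ℝ) := by
    have := Nat.mul_le_mul_left m (hb (Nat.le_succ i))
    exact_mod_cast (by simp at this; omega)
  have h2 : ((m * p : ℕ) : ℝ) < ((m * (p + 1) : ℕ) : ℝ) := by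
    exact_mod_cast Nat.mul_lt_mul_of_pos_left (Nat.lt_succ_self p) (by omega)
  have e1 : b i ≤ p ↔ ((m * b i + i : ℕ) : ℝ) < ((m * (p + 1) : ℕ) : ℝ) := by
    rw [Nat.cast_lt]
    constructor
    · intro h
      have := Nat.mul_le_mul_left m h
      rw [Nat.mul_succ]; omega
    · intro h
      by_contra h'
      have := Nat.mul_le_mul_left m (show p + 1 ≤ b i by omega)
      omega
  have e2 : p ≤ b (i + 1) ↔ ((m * p : ℕ) : ℝ) < ((m * b (i + 1) + (i + 1) : ℕ) : ℝ) := by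
    rw [Nat.cast_lt]
    constructor
    · intro h
      have := Nat.mul_le_mul_left m h
      omega
    · intro h
      by_contra h'
      have := Nat.mul_le_mul_left m (show b (i + 1) + 1 ≤ p by omega)
      rw [Nat.mul_succ] at this
      omega
  rw [e1, e2]
  unfold stair cor
  generalize ((m * b i + i : ℕ) : ℝ) = x at *
  generalize ((m * b (i + 1) + (i + 1) : ℕ) : ℝ) = x' at *
  generalize ((m * p : ℕ) : ℝ) = c at *
  generalize ((m * (p + 1) : ℕ) : ℝ) = c' at *
  constructor
  · intro h
    by_contra h'
    rw [not_and_or, not_lt, not_lt] at h'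
    apply h
    rcases h' with h' | h'
    · rw [min_eq_right (by linarith), min_eq_right (by linarith), min_eq_right (by linarith),
        min_eq_right (by linarith)]
      ring
    · rw [min_eq_left (by linarith), min_eq_left (by linarith), min_eq_left (by linarith),
        min_eq_left (by linarith)]
      ring
  · rintro ⟨h3, h4⟩
    apply ne_of_gt
    simp only [min_def]
    split_ifs <;> linarith

/-- The staircase construction with a permutation of the columns. -/
lemma good_stair (m n : ℕ) (hm : 2 ≤ m) (b : ℕ → ℕ) (hb : Monotone b) (hb0 : b 0 = 0)
    (hbm : b m + 1 = n) (e : Equiv.Perm (Fin n))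
    (h : (∀ i < m, ∀ j : Fin n, (b i ≤ j ∧ (j : ℕ) ≤ b (i + 1)) ∨ (b i ≤ e j ∧ (e j : ℕ) ≤ b (i + 1))) ∨
      (∀ i < m, ∀ j : Fin n, (b i ≤ e j ∧ (e j : ℕ) ≤ b (i + 1)) → ¬ (b i ≤ j ∧ (j : ℕ) ≤ b (i + 1)))) :
    Good m n := by
  classical
  set O : Matrix (Fin m) (Fin n) ℝ := fun i j => stair m b i j with hOdef
  have hrow : ∀ i : Fin m, ∑ j, O i j = ((m * (b (i + 1) - b i) + 1 : ℕ) : ℝ) := by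
    intro i
    simp only [hOdef]
    rw [Fin.sum_univ_eq_sum_range (fun p => stair m b i p) n]
    have h1 := Finset.sum_range_sub (fun p => cor m b (i + 1) p - cor m b i p) n
    have h2 : ∀ p, stair m b i p = (cor m b (i + 1) (p + 1) - cor m b i (p + 1)) -
      (cor m b (i + 1) p - cor m b i p) := fun p => rfl
    simp only [h2]
    rw [h1]
    have hle : ∀ k ≤ m, m * b k + k ≤ m * n := by
      intro k hk
      have := Nat.mul_le_mul_left m (hb hk)
      rw [← hbm, Nat.mul_succ]; omega
    have h3 : ∀ k ≤ m, cor m b k n = ((m * b k + k : ℕ) : ℝ) := by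
      intro k hk
      exact min_eq_left (by exact_mod_cast hle k hk)
    have h4 : ∀ k, cor m b k 0 = 0 := by
      intro k
      simp only [cor, Nat.mul_zero, Nat.cast_zero]
      exact min_eq_right (Nat.cast_nonneg _)
    rw [h3 _ i.2, h3 _ i.2.le, h4, h4]
    have h5 : b i ≤ b (i + 1) := hb (Nat.le_succ _)
    push_cast [Nat.cast_sub h5]
    ring
  have hcol : ∀ j : Fin n, ∑ i, O i j = ((m * 1 : ℕ) : ℝ) := by
    intro j
    simp only [hOdef]
    rw [Fin.sum_univ_eq_sum_range (fun i => stair m b i j) m]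
    have h1 := Finset.sum_range_sub (fun i => cor m b i (j + 1) - cor m b i j) m
    have h2 : ∀ i, stair m b i j = (cor m b (i + 1) (j + 1) - cor m b (i + 1) j) -
      (cor m b i (j + 1) - cor m b i j) := by
      intro i
      unfold stair
      ring
    simp only [h2]
    rw [h1]
    have h3 : ∀ p ≤ n, cor m b m p = ((m * p : ℕ) : ℝ) := by
      intro p hp
      refine min_eq_right ?_
      have := Nat.mul_le_mul_left m hp
      rw [← hbm, Nat.mul_succ] at this
      exact_mod_cast this
    have h4 : ∀ p, cor m b 0 p = 0 := by
      intro p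
      simp only [cor, hb0, Nat.mul_zero, Nat.add_zero, Nat.cast_zero]
      exact min_eq_left (Nat.cast_nonneg _)
    rw [h3 _ j.2, h3 _ j.2.le, h4, h4]
    push_cast
    ring
  have hne : ∀ i j, O i j ≠ 0 ↔ (b i ≤ j ∧ (j : ℕ) ≤ b (i + 1)) :=
    fun i j => stair_ne m b hb i j i.2
  have hcard : (supp O).card + 1 ≤ m + n := by
    have h1 : (supp O).card = ∑ i : Fin m, (Finset.univ.filter (fun j : Fin n => O i j ≠ 0)).card := by
      simp only [supp, Finset.card_filter]
      rw [Fintype.sum_prod_type]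
    have h2 : ∀ i : Fin m, (Finset.univ.filter (fun j : Fin n => O i j ≠ 0)).card ≤
        (b (i + 1) - b i) + 1 := by
      intro i
      have h5 : b i ≤ b (i + 1) := hb (Nat.le_succ _)
      have : (Finset.univ.filter (fun j : Fin n => O i j ≠ 0)).card ≤
          (Finset.Icc (b i) (b (i + 1))).card := by
        apply Finset.card_le_card_of_injOn (fun j : Fin n => (j : ℕ))
        · intro j hj
          simp only [Finset.coe_filter, Finset.mem_univ, true_and, Set.mem_ofPred_eq] at hj
          simpa using (hne i j).1 hj
        · exact Fin.val_injective.injOn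
      rw [Nat.card_Icc] at this
      omega
    have h3 := Finset.sum_le_sum (fun i (_ : i ∈ Finset.univ) => h2 i)
    rw [← h1, Finset.sum_add_distrib,
      Fin.sum_univ_eq_sum_range (fun i => b (i + 1) - b i) m, Finset.sum_range_tsub hb] at h3
    simp at h3
    omega
  have hO : O ∈ TP m n (fun i => ((m * (b (i + 1) - b i) + 1 : ℕ) : ℝ))
      (fun _ => ((m * 1 : ℕ) : ℝ)) :=
    ⟨fun i j => stair_nonneg m b hb i j, hrow, hcol⟩
  refine ⟨fun i => ((m * (b (i + 1) - b i) + 1 : ℕ) : ℝ), fun _ => ((m * 1 : ℕ) : ℝ), ?_, ?_, ?_,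
    O, fun i j => O i (e j), hO, ⟨fun i j => hO.1 i (e j), fun i => ?_, fun j => hcol (e j)⟩, hcard,
    ?_, ?_⟩
  · intro i; positivity
  · intro j
    have : 0 < m * 1 := by omega
    exact Nat.cast_pos.2 this
  · apply nondeg_of_mod (fun i : Fin m => b (i + 1) - b i) (fun _ : Fin n => 1)
    · intro _; omega
    · have : ∑ i, ∑ j, O i j = ∑ j, ∑ i, O i j := Finset.sum_comm
      simp only [hrow, hcol] at this
      exact_mod_cast this
  · refine Eq.trans ?_ (hrow i)
    exact Equiv.sum_comp e (fun j => O i j)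
  · have : (supp (fun i j => O i (e j) : Matrix (Fin m) (Fin n) ℝ)).card ≤ (supp O).card := by
      apply Finset.card_le_card_of_injOn (fun p : Fin m × Fin n => (p.1, e p.2))
      · rintro ⟨i, j⟩ h
        have h' := (mem_supp (fun i j => O i (e j) : Matrix (Fin m) (Fin n) ℝ) i j).1
          (Finset.mem_coe.1 h)
        exact Finset.mem_coe.2 ((mem_supp O i (e j)).2 h')
      · rintro ⟨i, j⟩ _ ⟨i', j'⟩ _ h
        simpa using h
    omega
  · rcases h with h | h
    · left
      intro i j h0
      have h1 := h i i.2 j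
      rw [← hne, ← hne] at h1
      tauto
    · right
      intro i j h0
      have h1 := h i i.2 j
      rw [← hne, ← hne] at h1
      tauto

lemma good_two (n : ℕ) (hn : 2 ≤ n) : Good 2 n := by
  refine good_stair 2 n le_rfl (fun i => min (i * (n / 2)) (n - 1)) ?_ (by simp) ?_ Fin.revPerm
    (Or.inl ?_)
  · intro i j hij
    exact min_le_min_right _ (Nat.mul_le_mul_right _ hij)
  · omega
  · intro i hi j
    have := j.2
    simp only [Fin.revPerm_apply, Fin.val_rev]
    interval_cases i <;> omega

lemma good_gen (m n : ℕ) (hm : 3 ≤ m) (hn : 4 ≤ n) (h : m = 3 → n ≠ 5) : Good m n := by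
  have : NeZero n := ⟨by omega⟩
  have hkey : n - 1 ≤ m * (n / 2 - 1) := by
    by_cases h3 : m = 3
    · subst h3
      have := h rfl
      omega
    · have : 4 * (n / 2 - 1) ≤ m * (n / 2 - 1) := Nat.mul_le_mul_right _ (by omega)
      omega
  refine good_stair m n (by omega) (fun i => min (i * (n / 2 - 1)) (n - 1)) ?_ (by simp) ?_
    (Equiv.addRight (⟨n / 2, by omega⟩ : Fin n)) (Or.inr ?_)
  · intro i j hij
    exact min_le_min_right _ (Nat.mul_le_mul_right _ hij)
  · simp only [min_eq_right hkey]
    omega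
  · intro i hi j
    have hj := j.2
    simp only [Equiv.coe_addRight, Fin.val_add, Nat.add_mul, Nat.one_mul]
    have hmod : ((j : ℕ) + n / 2) % n = j + n / 2 ∨ ((j : ℕ) + n / 2) % n + n = j + n / 2 := by
      by_cases hlt : (j : ℕ) + n / 2 < n
      · left; exact Nat.mod_eq_of_lt hlt
      · right
        rw [Nat.mod_eq_sub_mod (by omega), Nat.mod_eq_of_lt (by omega)]
        omega
    generalize ((j : ℕ) + n / 2) % n = q at *
    generalize i * (n / 2 - 1) = t at *
    omega

/-- Explicit data given by natural number tables. -/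
lemma good_table (m n : ℕ) (hm : 0 < m) (c : Fin m → ℕ) (d : Fin n → ℕ) (hd : ∀ j, 0 < m * d j)
    (O F : Fin m → Fin n → ℕ) (hO1 : ∀ i, ∑ j, O i j = m * c i + 1)
    (hO2 : ∀ j, ∑ i, O i j = m * d j) (hF1 : ∀ i, ∑ j, F i j = m * c i + 1)
    (hF2 : ∀ j, ∑ i, F i j = m * d j)
    (hO : (Finset.univ.filter (fun p : Fin m × Fin n => O p.1 p.2 ≠ 0)).card + 1 ≤ m + n)
    (hF : (Finset.univ.filter (fun p : Fin m × Fin n => F p.1 p.2 ≠ 0)).card + 1 ≤ m + n)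
    (h : (∀ i j, O i j = 0 → F i j ≠ 0) ∨ (∀ i j, F i j ≠ 0 → O i j = 0)) : Good m n := by
  classical
  refine ⟨fun i => ((m * c i + 1 : ℕ) : ℝ), fun j => ((m * d j : ℕ) : ℝ), fun i => by positivity,
    fun j => Nat.cast_pos.2 (hd j), nondeg_of_mod c d hd ?_,
    fun i j => (O i j : ℝ), fun i j => (F i j : ℝ), ⟨fun i j => by positivity, fun i => ?_, fun j => ?_⟩,
    ⟨fun i j => by positivity, fun i => ?_, fun j => ?_⟩, ?_, ?_, ?_⟩
  · simp only [← hO1, ← hO2]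
    exact Finset.sum_comm
  · beta_reduce
    exact_mod_cast hO1 i
  · beta_reduce
    exact_mod_cast hO2 j
  · beta_reduce
    exact_mod_cast hF1 i
  · beta_reduce
    exact_mod_cast hF2 j
  · refine le_trans (le_of_eq ?_) hO
    congr 2
    ext p
    simp [supp]
  · refine le_trans (le_of_eq ?_) hF
    congr 2
    ext p
    simp [supp]
  · beta_reduce
    exact_mod_cast h

lemma good_33 : Good 3 3 :=
  good_table 3 3 (by norm_num) ![1, 1, 1] ![1, 1, 2] (by decide)
    ![![3, 1, 0], ![0, 2, 2], ![0, 0, 4]] ![![0, 0, 4], ![2, 0, 2], ![1, 3, 0]]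
    (by decide) (by decide) (by decide) (by decide) (by decide) (by decide) (Or.inl (by decide))

lemma good_35 : Good 3 5 :=
  good_table 3 5 (by norm_num) ![1, 2, 2] ![1, 1, 1, 1, 2] (by decide)
    ![![3, 1, 0, 0, 0], ![0, 2, 3, 2, 0], ![0, 0, 0, 1, 6]]
    ![![0, 0, 0, 3, 1], ![2, 0, 0, 0, 5], ![1, 3, 3, 0, 0]]
    (by decide) (by decide) (by decide) (by decide) (by decide) (by decide) (Or.inr (by decide))

lemma good_all (m n : ℕ) (hm : 2 ≤ m) (hn : 2 ≤ n) : Good m n := by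
  have h3 : ∀ n, 3 ≤ n → Good 3 n := by
    intro n hn
    by_cases h : n = 3
    · subst h; exact good_33
    · by_cases h5 : n = 5
      · subst h5; exact good_35
      · exact good_gen 3 n le_rfl (by omega) (fun _ => h5)
  by_cases h : m = 2
  · subst h; exact good_two n hn
  by_cases h' : n = 2
  · subst h'; exact good_symm (good_two m hm)
  by_cases h1 : m = 3
  · subst h1; exact h3 n (by omega)
  by_cases h1' : n = 3
  · subst h1'; exact good_symm (h3 m (by omega))
  exact good_gen m n (by omega) (by omega) (fun h => absurd h h1)

/-- for all m, n ≥ 2 there are positive margins and two vertices of the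
m×n transportation polytope whose graph distance is at least min{(m−1)(n−1), m+n−1}. -/
theorem stmt_2 (m n : ℕ) (hm : 2 ≤ m) (hn : 2 ≤ n) :
    ∃ (u : Fin m → ℝ) (v : Fin n → ℝ),
      (∀ i, 0 < u i) ∧ (∀ j, 0 < v j) ∧ (∑ i, u i = ∑ j, v j) ∧
      ∃ O F : Matrix (Fin m) (Fin n) ℝ,
        O ∈ Set.extremePoints ℝ (TP m n u v) ∧
        F ∈ Set.extremePoints ℝ (TP m n u v) ∧
        ∀ (k : ℕ) (w : ℕ → Matrix (Fin m) (Fin n) ℝ),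
          w 0 = O → w k = F →
          (∀ i < k, AdjVert m n u v (w i) (w (i + 1))) →
          min ((m - 1) * (n - 1)) (m + n - 1) ≤ k := by
  exact good_main m n hm hn (good_all m n hm hn)
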